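/- The solution set X = argmin_{x ∈ ℝ^n} L(x) admits an extreme point if and only if X is compact, if and only if Ker Φ ∩ Ker D* = {0}. Moreover, a solution x ∈ X is an extreme point of X if and only if Ker Φ ∩ Ker D*_J = {0}, where J = cosupp(D*x). -/

import Mathlib

open Matrix Set

noncomputable section

/-- `Vec n` is `ℝ^n`. -/
abbrev Vec (n : ℕ) := Fin n → ℝ

/-- The ℓ¹-norm on `ℝ^p`. -/
def l1 {p : ℕ} (θ : Vec p) : ℝ := ∑ i, |θ i|

/-- The componentwise sign vector. -/
def sgn {p : ℕ} (θ : Vec p) : Vec p := fun i => Real.sign (θ i)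

/-- `s` is a sign vector, i.e. `s ∈ {-1,0,1}^p`. -/
def IsSignVec {p : ℕ} (s : Vec p) : Prop := ∀ i, s i = -1 ∨ s i = 0 ∨ s i = 1

/-- The order `s ≼ s'` on sign vectors: `sᵢ ≠ 0 → s'ᵢ = sᵢ`. -/
def sleq {p : ℕ} (s s' : Vec p) : Prop := ∀ i, s i ≠ 0 → s' i = s i

/-- The cosupport `{i : uᵢ = 0}`. -/
def cosupp {p : ℕ} (u : Vec p) : Set (Fin p) := {i | u i = 0}

/-- The analysis operator `D* x = Dᵀ x`. -/
def Dstar {n p : ℕ} (D : Matrix (Fin n) (Fin p) ℝ) (x : Vec n) : Vec p := Dᵀ *ᵥ x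

/-- The ball `B_r = {x : ‖D*x‖₁ ≤ r}`. -/
def Ball {n p : ℕ} (D : Matrix (Fin n) (Fin p) ℝ) (r : ℝ) : Set (Vec n) :=
  {x | l1 (Dstar D x) ≤ r}

/-- The sphere `∂B_r = {x : ‖D*x‖₁ = r}`. -/
def Sph {n p : ℕ} (D : Matrix (Fin n) (Fin p) ℝ) (r : ℝ) : Set (Vec n) :=
  {x | l1 (Dstar D x) = r}

/-- `Ker D*_J = {x : (D*x)ᵢ = 0 for all i ∈ J}`. -/
def kerDJ {n p : ℕ} (D : Matrix (Fin n) (Fin p) ℝ) (J : Set (Fin p)) : Set (Vec n) :=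
  {x | ∀ i ∈ J, Dstar D x i = 0}

/-- The relative interior of a set. -/
def ri {n : ℕ} (C : Set (Vec n)) : Set (Vec n) := intrinsicInterior ℝ C

/-- The direction of (the affine hull of) a set, as a set of vectors. -/
def dir {n : ℕ} (C : Set (Vec n)) : Set (Vec n) := ((affineSpan ℝ C).direction : Set (Vec n))

/-- `F` is an exposed face of `X`: the intersection of `X` with a supporting hyperplane. -/
def IsExposedFace {n : ℕ} (X F : Set (Vec n)) : Prop :=
  ∃ (α : Vec n) (β : ℝ), α ≠ 0 ∧ (∀ x ∈ X, α ⬝ᵥ x ≤ β) ∧ F = X ∩ {x | α ⬝ᵥ x = β}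

/-- `G` is a face of `X`: a convex extreme subset of `X`. -/
def IsFace {n : ℕ} (X G : Set (Vec n)) : Prop := Convex ℝ G ∧ IsExtreme ℝ X G

/-- `x` is an extreme point of `C`: it is not the midpoint of two distinct points of `C`. -/
def IsExtremePt {n : ℕ} (C : Set (Vec n)) (x : Vec n) : Prop :=
  x ∈ C ∧ ∀ x₁ ∈ C, ∀ x₂ ∈ C, x = midpoint ℝ x₁ x₂ → x₁ = x₂

/-- The objective `L(x) = (1/2)‖y − Φx‖₂² + λ‖D*x‖₁`. -/
def Lfun {n p q : ℕ} (D : Matrix (Fin n) (Fin p) ℝ) (Phi : Matrix (Fin q) (Fin n) ℝ)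
    (y : Vec q) (lam : ℝ) (x : Vec n) : ℝ :=
  (1/2 : ℝ) * ((y - Phi *ᵥ x) ⬝ᵥ (y - Phi *ᵥ x)) + lam * l1 (Dstar D x)

theorem Lfun_second {n p q : ℕ} (D : Matrix (Fin n) (Fin p) ℝ) (Phi : Matrix (Fin q) (Fin n) ℝ)
    (y : Vec q) (lam : ℝ) (x k : Vec n) :
    Lfun D Phi y lam (x + k) + Lfun D Phi y lam (x - k) - 2 * Lfun D Phi y lam x =
      (Phi *ᵥ k) ⬝ᵥ (Phi *ᵥ k) + lam * ∑ i, (|Dstar D x i + Dstar D k i| +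
        |Dstar D x i - Dstar D k i| - 2 * |Dstar D x i|) := by
  have h1 : l1 (Dstar D (x + k)) = ∑ i, |Dstar D x i + Dstar D k i| := by
    simp [l1, Dstar, Matrix.mulVec_add]
  have h2 : l1 (Dstar D (x - k)) = ∑ i, |Dstar D x i - Dstar D k i| := by
    simp [l1, Dstar, Matrix.mulVec_sub]
  have h3 : l1 (Dstar D x) = ∑ i, |Dstar D x i| := rfl
  unfold Lfun
  rw [h1, h2, h3, Finset.sum_sub_distrib, Finset.sum_add_distrib, ← Finset.mul_sum,
    Matrix.mulVec_add, Matrix.mulVec_sub]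
  simp only [sub_dotProduct, dotProduct_sub, add_dotProduct, dotProduct_add]
  ring

theorem abs_second_nonneg (a b : ℝ) : 0 ≤ |a + b| + |a - b| - 2 * |a| := by
  have h := abs_add_le (a + b) (a - b)
  have h2 : (a + b) + (a - b) = 2 * a := by ring
  rw [h2, abs_mul, abs_two] at h
  linarith

theorem abs_second_zero (a b : ℝ) (h : |b| ≤ |a|) : |a + b| + |a - b| - 2 * |a| = 0 := by
  grind

theorem ext_iff_ker {n p q : ℕ}
    (D : Matrix (Fin n) (Fin p) ℝ) (Phi : Matrix (Fin q) (Fin n) ℝ)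
    (y : Vec q) (lam : ℝ) (hlam : 0 < lam)
    (X : Set (Vec n)) (hX : X = {x : Vec n | ∀ z, Lfun D Phi y lam x ≤ Lfun D Phi y lam z})
    (x : Vec n) (hx : x ∈ X) : IsExtremePt X x ↔
      {k : Vec n | Phi *ᵥ k = 0} ∩ kerDJ D (cosupp (Dstar D x)) = {0} := by
  have hxm : ∀ z, Lfun D Phi y lam x ≤ Lfun D Phi y lam z := by
    rw [hX] at hx; exact hx
  have hmem : ∀ w, Lfun D Phi y lam w ≤ Lfun D Phi y lam x → w ∈ X := by
    intro w hw; rw [hX]; intro z; exact hw.trans (hxm z)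
  constructor
  · rintro ⟨-, he⟩
    apply Set.eq_singleton_iff_unique_mem.2
    refine ⟨⟨by simp, by intro i _; simp [Dstar]⟩, ?_⟩
    rintro k ⟨hk1, hk2⟩
    have hev : ∀ᶠ t : ℝ in nhdsWithin 0 (Set.Ioi 0),
        ∀ i, |t * Dstar D k i| ≤ |Dstar D x i| := by
      rw [Filter.eventually_all]
      intro i
      by_cases ha : Dstar D x i = 0
      · have : Dstar D k i = 0 := hk2 i ha
        simp [this]
      · apply Filter.Eventually.filter_mono nhdsWithin_le_nhds
        have hc : Filter.Tendsto (fun t : ℝ => |t * Dstar D k i|) (nhds 0) (nhds 0) := by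
          have : Continuous (fun t : ℝ => |t * Dstar D k i|) := by fun_prop
          simpa using this.tendsto 0
        exact (hc.eventually_lt_const (abs_pos.2 ha)).mono fun t ht => ht.le
    obtain ⟨t, ht, ht0⟩ := (hev.and self_mem_nhdsWithin).exists
    have ht0 : 0 < t := ht0
    have hD : ∀ i, Dstar D (t • k) i = t * Dstar D k i := by
      intro i; simp [Dstar, Matrix.mulVec_smul]
    have hs := Lfun_second D Phi y lam x (t • k)
    have hk1 : Phi *ᵥ k = 0 := hk1
    rw [Matrix.mulVec_smul, hk1, Finset.sum_eq_zero] at hs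
    · simp at hs
      have e1 := hxm (x + t • k)
      have e2 := hxm (x - t • k)
      have := he _ (hmem (x + t • k) (by linarith)) _ (hmem (x - t • k) (by linarith))
        (by simp)
      have h0 : t • k = 0 := by
        ext i
        have := congrFun this i
        simp only [Pi.add_apply, Pi.sub_apply] at this
        simp only [Pi.zero_apply]
        linarith
      exact (smul_eq_zero.1 h0).resolve_left ht0.ne'
    · intro i _
      rw [hD]
      exact abs_second_zero _ _ (ht i)
  · intro hker
    refine ⟨hx, ?_⟩
    intro x₁ h₁ x₂ h₂ hm
    rw [hX] at h₁ h₂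
    set k : Vec n := (1/2 : ℝ) • (x₁ - x₂) with hk
    have hxe : x = (1/2 : ℝ) • (x₁ + x₂) := by
      rw [hm, midpoint_eq_smul_add]; simp
    have e1 : x + k = x₁ := by rw [hxe, hk]; ext i; simp; ring
    have e2 : x - k = x₂ := by rw [hxe, hk]; ext i; simp; ring
    have hs := Lfun_second D Phi y lam x k
    rw [e1, e2] at hs
    have a1 := h₁ x
    have a2 := h₂ x
    have hsum : 0 ≤ ∑ i, (|Dstar D x i + Dstar D k i| +
        |Dstar D x i - Dstar D k i| - 2 * |Dstar D x i|) :=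
      Finset.sum_nonneg fun i _ => abs_second_nonneg _ _
    have hq : 0 ≤ (Phi *ᵥ k) ⬝ᵥ (Phi *ᵥ k) :=
      Finset.sum_nonneg fun i _ => mul_self_nonneg _
    have hl := mul_nonneg hlam.le hsum
    have z1 : (Phi *ᵥ k) ⬝ᵥ (Phi *ᵥ k) = 0 := by linarith
    have z2 : lam * ∑ i, (|Dstar D x i + Dstar D k i| +
        |Dstar D x i - Dstar D k i| - 2 * |Dstar D x i|) = 0 := by linarith
    have z3 := (mul_eq_zero.1 z2).resolve_left hlam.ne'
    rw [Finset.sum_eq_zero_iff_of_nonneg (fun i _ => abs_second_nonneg _ _)] at z3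
    have hkm : k ∈ {k : Vec n | Phi *ᵥ k = 0} ∩ kerDJ D (cosupp (Dstar D x)) := by
      refine ⟨dotProduct_self_eq_zero.1 z1, ?_⟩
      intro i hi
      have hi : Dstar D x i = 0 := hi
      have := z3 i (Finset.mem_univ i)
      rw [hi] at this
      simp at this
      exact this
    rw [hker] at hkm
    have hk0 : k = 0 := hkm
    rw [← e1, ← e2, hk0]; simp

/-- The outer function. -/
def Fout {p q : ℕ} (y : Vec q) (lam : ℝ) (w : Vec q × Vec p) : ℝ :=
  (1/2 : ℝ) * ((y - w.1) ⬝ᵥ (y - w.1)) + lam * l1 w.2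

theorem Fout_cont {p q : ℕ} (y : Vec q) (lam : ℝ) :
    Continuous (Fout y lam : Vec q × Vec p → ℝ) := by
  unfold Fout l1 dotProduct
  fun_prop

theorem Fout_compact {p q : ℕ} (y : Vec q) (lam : ℝ) (hlam : 0 < lam) (c : ℝ) :
    IsCompact {w : Vec q × Vec p | Fout y lam w ≤ c} := by
  have hb : {w : Vec q × Vec p | Fout y lam w ≤ c} ⊆
      (Set.Icc (fun i => y i - (2 * c + 1)) (fun i => y i + (2 * c + 1))) ×ˢ
      (Set.Icc (fun _ => -(c / lam)) (fun _ => c / lam)) := by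
    rintro ⟨u, v⟩ hw
    have hw : (1/2 : ℝ) * ((y - u) ⬝ᵥ (y - u)) + lam * l1 v ≤ c := hw
    have hv0 : 0 ≤ l1 v := Finset.sum_nonneg fun i _ => abs_nonneg _
    have hu0 : 0 ≤ (y - u) ⬝ᵥ (y - u) := Finset.sum_nonneg fun i _ => mul_self_nonneg _
    have hl := mul_nonneg hlam.le hv0
    have hu : ∀ i, (y i - u i) * (y i - u i) ≤ 2 * c := by
      intro i
      have : (y i - u i) * (y i - u i) ≤ (y - u) ⬝ᵥ (y - u) :=
        Finset.single_le_sum (f := fun i => (y - u) i * (y - u) i)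
          (fun i _ => mul_self_nonneg _) (Finset.mem_univ i)
      linarith
    have hv : ∀ i, |v i| ≤ c / lam := by
      intro i
      have : |v i| ≤ l1 v := Finset.single_le_sum (f := fun i => |v i|)
          (fun i _ => abs_nonneg _) (Finset.mem_univ i)
      rw [le_div_iff₀ hlam]
      nlinarith
    refine ⟨⟨fun i => ?_, fun i => ?_⟩, ⟨fun i => (abs_le.1 (hv i)).1, fun i => (abs_le.1 (hv i)).2⟩⟩
    · have := hu i
      simp only
      nlinarith [sq_nonneg (y i - u i + 1), sq_nonneg (y i - u i - 1)]
    · have := hu i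
      simp only
      nlinarith [sq_nonneg (y i - u i + 1), sq_nonneg (y i - u i - 1)]
  exact (isCompact_Icc.prod isCompact_Icc).of_isClosed_subset
    (isClosed_le (Fout_cont y lam) continuous_const) hb

/-- The joint linear map. -/
def Amap {n p q : ℕ} (D : Matrix (Fin n) (Fin p) ℝ) (Phi : Matrix (Fin q) (Fin n) ℝ) :
    Vec n →ₗ[ℝ] Vec q × Vec p := (Matrix.mulVecLin Phi).prod (Matrix.mulVecLin Dᵀ)

theorem Lfun_eq {n p q : ℕ} (D : Matrix (Fin n) (Fin p) ℝ) (Phi : Matrix (Fin q) (Fin n) ℝ)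
    (y : Vec q) (lam : ℝ) (x : Vec n) : Lfun D Phi y lam x = Fout y lam (Amap D Phi x) := rfl

theorem exists_min {n p q : ℕ} (D : Matrix (Fin n) (Fin p) ℝ) (Phi : Matrix (Fin q) (Fin n) ℝ)
    (y : Vec q) (lam : ℝ) (hlam : 0 < lam) :
    ∃ x, ∀ z, Lfun D Phi y lam x ≤ Lfun D Phi y lam z := by
  have hcl : IsClosed ((LinearMap.range (Amap D Phi) : Submodule ℝ (Vec q × Vec p)) :
    Set (Vec q × Vec p)) := Submodule.closed_of_finiteDimensional _
  have hK := (Fout_compact (p := p) y lam hlam (Lfun D Phi y lam 0)).inter_right hcl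
  obtain ⟨w, ⟨hw1, ⟨x, rfl⟩⟩, hw⟩ := hK.exists_isMinOn
    ⟨Amap D Phi 0, (Lfun_eq D Phi y lam 0).ge, LinearMap.mem_range_self _ 0⟩ (Fout_cont y lam).continuousOn
  refine ⟨x, fun z => ?_⟩
  rcases le_total (Lfun D Phi y lam z) (Lfun D Phi y lam 0) with h | h
  · rw [Lfun_eq, Lfun_eq]
    refine isMinOn_iff.1 hw (Amap D Phi z) ⟨?_, LinearMap.mem_range_self _ z⟩
    rw [Set.mem_setOf_eq, ← Lfun_eq]
    exact h
  · rw [Set.mem_setOf_eq, ← Lfun_eq] at hw1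
    exact le_trans hw1 h

/-- the solution set `X = argmin L` admits an extreme point iff it is compact iff
`Ker Φ ∩ Ker D* = {0}`; and `x ∈ X` is an extreme point of `X` iff `Ker Φ ∩ Ker D*_J = {0}`
where `J = cosupp(D*x)`. -/
theorem stmt_18 {n p q : ℕ} (hn : 0 < n) (hp : 0 < p) (hq : 0 < q)
    (D : Matrix (Fin n) (Fin p) ℝ) (Phi : Matrix (Fin q) (Fin n) ℝ)
    (y : Vec q) (lam : ℝ) (hlam : 0 < lam)
    (X : Set (Vec n)) (hX : X = {x : Vec n | ∀ z, Lfun D Phi y lam x ≤ Lfun D Phi y lam z}) :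
    ((∃ z, IsExtremePt X z) ↔ IsCompact X) ∧
    ((∃ z, IsExtremePt X z) ↔
      {x : Vec n | Phi *ᵥ x = 0} ∩ {x : Vec n | Dstar D x = 0} = {0}) ∧
    (∀ x ∈ X, (IsExtremePt X x ↔
      {k : Vec n | Phi *ᵥ k = 0} ∩ kerDJ D (cosupp (Dstar D x)) = {0})) := by
  have hex := ext_iff_ker D Phi y lam hlam X hX
  obtain ⟨x₀, hx₀⟩ := exists_min D Phi y lam hlam
  have hx₀X : x₀ ∈ X := by rw [hX]; exact hx₀
  have h1 : (∃ z, IsExtremePt X z) →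
      {x : Vec n | Phi *ᵥ x = 0} ∩ {x : Vec n | Dstar D x = 0} = {0} := by
    rintro ⟨z, hz⟩
    have hk := (hex z hz.1).1 hz
    apply Set.eq_singleton_iff_unique_mem.2
    refine ⟨⟨by simp, by simp [Dstar]⟩, ?_⟩
    rintro k ⟨hk1, hk2⟩
    have hk2 : Dstar D k = 0 := hk2
    have : k ∈ {k : Vec n | Phi *ᵥ k = 0} ∩ kerDJ D (cosupp (Dstar D z)) :=
      ⟨hk1, fun i _ => by rw [hk2]; rfl⟩
    rw [hk] at this
    exact this
  have h2 : {x : Vec n | Phi *ᵥ x = 0} ∩ {x : Vec n | Dstar D x = 0} = {0} → IsCompact X := by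
    intro hk
    have hinj : LinearMap.ker (Amap D Phi) = ⊥ := by
      rw [LinearMap.ker_eq_bot']
      intro m hm
      have : m ∈ {x : Vec n | Phi *ᵥ x = 0} ∩ {x : Vec n | Dstar D x = 0} :=
        ⟨congrArg Prod.fst hm, congrArg Prod.snd hm⟩
      rw [hk] at this
      exact this
    have hce := LinearMap.isClosedEmbedding_of_injective hinj
    have hXe : X = Amap D Phi ⁻¹' {w | Fout y lam w ≤ Lfun D Phi y lam x₀} := by
      rw [hX]
      ext x
      exact ⟨fun h => h x₀, fun h z => le_trans h (hx₀ z)⟩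
    rw [hXe]
    exact hce.isCompact_preimage (Fout_compact y lam hlam _)
  have h3 : IsCompact X → ∃ z, IsExtremePt X z := by
    intro hc
    obtain ⟨z, hz⟩ := hc.extremePoints_nonempty ⟨x₀, hx₀X⟩
    rw [mem_extremePoints] at hz
    refine ⟨z, hz.1, fun x₁ m₁ x₂ m₂ hm => ?_⟩
    have := hz.2 x₁ m₁ x₂ m₂ (by rw [hm]; exact midpoint_mem_openSegment x₁ x₂)
    exact this.1.trans this.2.symm
  exact ⟨⟨fun h => h2 (h1 h), h3⟩, ⟨h1, fun h => h3 (h2 h)⟩, hex⟩
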